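/- Let v₁, …, v_{r+1} be linearly independent vectors in ℝᵐ forming the columns of V ∈ ℝ^{m×(r+1)}. Suppose V = Q R where Q ∈ ℝ^{m×(r+1)} has orthonormal columns and R ∈ ℝ^{(r+1)×(r+1)} is invertible, and let R₂ ∈ ℝ^{(r+1)×r} consist of the last r columns of R. Suppose further R₂ = Z S where Z ∈ ℝ^{(r+1)×r} has orthonormal columns and S ∈ ℝ^{r×r} is invertible. Then the matrix Q Z ∈ ℝ^{m×r} has orthonormal columns and its column span equals span{v₂, …, v_{r+1}}. -/

import Mathlib

open Matrix

/-- Right multiplication by an invertible matrix preserves the column span. -/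
theorem span_range_col_mul_of_isUnit {K m n : Type*} [CommRing K] [Fintype n] [DecidableEq n]
    (A : Matrix m n K) {S : Matrix n n K} (hS : IsUnit S) :
    Submodule.span K (Set.range (A * S).col) = Submodule.span K (Set.range A.col) := by
  rw [← Matrix.range_mulVecLin, ← Matrix.range_mulVecLin, Matrix.mulVecLin_mul]
  exact LinearMap.range_comp_of_range_eq_top _
    (LinearMap.range_eq_top.2 (Matrix.mulVec_surjective_iff_isUnit.2 hS))

/-- Correctness of the incremental Gram–Schmidt basis update: given linearly
independent columns `v₁, …, v_{r+1}` of `V = Q R` with `Q` orthonormal and `R`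
invertible, if the last `r` columns `R₂` of `R` factor as `R₂ = Z S` with `Z`
orthonormal and `S` invertible, then `Q Z` has orthonormal columns and its
column span equals `span{v₂, …, v_{r+1}}`. -/
theorem incremental_basis_update_correct
    (m r : ℕ) (V : Matrix (Fin m) (Fin (r + 1)) ℝ)
    (hV : LinearIndependent ℝ (fun j : Fin (r + 1) => fun i : Fin m => V i j))
    (Q : Matrix (Fin m) (Fin (r + 1)) ℝ) (R : Matrix (Fin (r + 1)) (Fin (r + 1)) ℝ)
    (hQR : V = Q * R) (hQ : Qᵀ * Q = 1) (hR : IsUnit R)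
    (R₂ : Matrix (Fin (r + 1)) (Fin r) ℝ) (hR₂ : R₂ = R.submatrix id Fin.succ)
    (Z : Matrix (Fin (r + 1)) (Fin r) ℝ) (S : Matrix (Fin r) (Fin r) ℝ)
    (hZS : R₂ = Z * S) (hZ : Zᵀ * Z = 1) (hS : IsUnit S) :
    (Q * Z)ᵀ * (Q * Z) = 1 ∧
      Submodule.span ℝ (Set.range fun j : Fin r => fun i : Fin m => (Q * Z) i j) =
        Submodule.span ℝ (Set.range fun j : Fin r => fun i : Fin m => V i j.succ) := by
  constructor
  · rw [Matrix.transpose_mul, Matrix.mul_assoc, ← Matrix.mul_assoc Qᵀ, hQ, Matrix.one_mul, hZ]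
  · have hV₂ : V.submatrix id Fin.succ = Q * Z * S := by
      rw [Matrix.mul_assoc, ← hZS, hR₂, hQR]
      rfl
    have h := span_range_col_mul_of_isUnit (Q * Z) hS
    rw [← hV₂] at h
    exact h.symm
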